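/- The function g : [0,∞) → ℝ given by g(T) = I(X₁,X₂,X₃,X₄; Y₁₅), where the times are set to T₁₅ = T and all other times are 0 (so Y₁₅ is Poisson with rate T·(X₁+X₂+X₃+X₄) given X), is concave on [0,∞). -/

import Mathlib

open MeasureTheory ProbabilityTheory Real Filter

noncomputable section

/-- Shannon entropy of a measure: the sum of `-q * log q` over the normalized
masses of singletons (Mathlib-style `measureEntropy`). -/
def measureEntropy {S : Type*} [MeasurableSpace S] (μ : Measure S) : ℝ :=
  ∑' s, Real.negMulLog (((μ Set.univ)⁻¹ • μ) {s}).toReal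

/-- Mutual information of a joint law on a product space:
`I(X;Y) = H(X) + H(Y) - H(X,Y)`. -/
def measureMutualInfo {S U : Type*} [MeasurableSpace S] [MeasurableSpace U]
    (μ : Measure (S × U)) : ℝ :=
  measureEntropy (μ.map Prod.fst) + measureEntropy (μ.map Prod.snd) - measureEntropy μ

/-- The 15 nonempty subsets of `{1,2,3,4}` (coded as `Fin 4`), in the paper's order:
`S₁={1}, S₂={2}, S₃={3}, S₄={4}, S₅={1,2}, S₆={1,3}, S₇={1,4}, S₈={2,3}, S₉={2,4},
S₁₀={3,4}, S₁₁={1,2,3}, S₁₂={1,2,4}, S₁₃={1,3,4}, S₁₄={2,3,4}, S₁₅={1,2,3,4}`. -/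
def sens : Fin 15 → Finset (Fin 4) :=
  ![{0}, {1}, {2}, {3}, {0,1}, {0,2}, {0,3}, {1,2}, {1,3}, {2,3},
    {0,1,2}, {0,1,3}, {0,2,3}, {1,2,3}, {0,1,2,3}]

/-- Law of one input component: `λ₁` with probability `p`, `λ₀` with probability `1-p`. -/
def inputLaw (p lam0 lam1 : ℝ) : Measure ℝ :=
  ENNReal.ofReal p • Measure.dirac lam1 + ENNReal.ofReal (1 - p) • Measure.dirac lam0

/-- Law of the input vector `X = (X₁,X₂,X₃,X₄)` with i.i.d. components. -/
def XLaw (p lam0 lam1 : ℝ) : Measure (Fin 4 → ℝ) :=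
  Measure.pi fun _ => inputLaw p lam0 lam1

/-- Poisson distribution on `ℕ` with (nonnegative) real rate `r`;
rate `0` gives the Dirac mass at `0`. -/
def poissonMeasure (r : ℝ) : Measure ℕ :=
  (poissonPMF r.toNNReal).toMeasure

/-- Joint law of `(X, (Y_{idx 1}, …, Y_{idx k}))` in the vector Poisson channel:
conditionally on `X = x`, the indicated outputs are independent with
`Y_i ~ Poisson (T i * ∑_{j ∈ Sᵢ} x j)`. -/
def poissonJointLaw (p lam0 lam1 : ℝ) (T : Fin 15 → ℝ) {k : ℕ} (idx : Fin k → Fin 15) :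
    Measure ((Fin 4 → ℝ) × (Fin k → ℕ)) :=
  (XLaw p lam0 lam1).bind fun x =>
    (Measure.pi fun i => poissonMeasure (T (idx i) * ∑ j ∈ sens (idx i), x j)).map
      (fun y => (x, y))

/-- A sequence of functions is exponentially bounded on `D` if `|a n t| ≤ C * K ^ n` for all
`t ∈ D`, with constants that do not depend on `n` and `t`. -/
def ExpBounded (D : Set ℝ) (a : ℕ → ℝ → ℝ) : Prop :=
  ∃ C K : ℝ, 0 ≤ C ∧ 0 ≤ K ∧ ∀ n, ∀ t ∈ D, |a n t| ≤ C * K ^ n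

namespace ExpBounded

variable {D : Set ℝ} {a b : ℕ → ℝ → ℝ}

lemma of_abs_le (hb : ExpBounded D b) (h : ∀ n, ∀ t ∈ D, |a n t| ≤ |b n t|) : ExpBounded D a := by
  obtain ⟨C, K, hC, hK, hb⟩ := hb
  exact ⟨C, K, hC, hK, fun n t ht => (h n t ht).trans (hb n t ht)⟩

lemma add (ha : ExpBounded D a) (hb : ExpBounded D b) :
    ExpBounded D (fun n t => a n t + b n t) := by
  obtain ⟨C, K, hC, hK, ha⟩ := ha
  obtain ⟨C', K', hC', hK', hb⟩ := hb
  refine ⟨C + C', max K K', by positivity, le_max_of_le_left hK, fun n t ht => ?_⟩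
  calc |a n t + b n t| ≤ |a n t| + |b n t| := abs_add_le _ _
    _ ≤ C * K ^ n + C' * K' ^ n := add_le_add (ha n t ht) (hb n t ht)
    _ ≤ C * (max K K') ^ n + C' * (max K K') ^ n := by
        gcongr
        · exact le_max_left _ _
        · exact le_max_right _ _
    _ = _ := by ring

lemma mul (ha : ExpBounded D a) (hb : ExpBounded D b) :
    ExpBounded D (fun n t => a n t * b n t) := by
  obtain ⟨C, K, hC, hK, ha⟩ := ha
  obtain ⟨C', K', hC', hK', hb⟩ := hb
  refine ⟨C * C', K * K', by positivity, by positivity, fun n t ht => ?_⟩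
  calc |a n t * b n t| = |a n t| * |b n t| := abs_mul _ _
    _ ≤ (C * K ^ n) * (C' * K' ^ n) :=
        mul_le_mul (ha n t ht) (hb n t ht) (abs_nonneg _) (by positivity)
    _ = _ := by ring

lemma neg (ha : ExpBounded D a) : ExpBounded D (fun n t => -a n t) :=
  ha.of_abs_le fun _ _ _ => (abs_neg _).le

lemma sub (ha : ExpBounded D a) (hb : ExpBounded D b) :
    ExpBounded D (fun n t => a n t - b n t) := by
  simpa only [sub_eq_add_neg] using ha.add hb.neg

lemma of_const_pow (c r : ℝ) : ExpBounded D (fun n _ => c * r ^ n) :=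
  ⟨|c|, |r|, abs_nonneg _, abs_nonneg _, fun n t _ => by rw [abs_mul, abs_pow]⟩

lemma const (c : ℝ) : ExpBounded D (fun _ _ => c) := by
  simpa using of_const_pow (D := D) c 1

lemma natCast : ExpBounded D (fun n _ => (n : ℝ)) := by
  refine (of_const_pow (D := D) 1 2).of_abs_le fun n t _ => ?_
  rw [Nat.abs_cast, one_mul, abs_of_nonneg (by positivity)]
  exact_mod_cast Nat.lt_two_pow_self.le

lemma shift (ha : ExpBounded D a) : ExpBounded D (fun n t => a (n + 1) t) := by
  obtain ⟨C, K, hC, hK, ha⟩ := ha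
  refine ⟨C * K, K, by positivity, hK, fun n t ht => (ha (n + 1) t ht).trans_eq ?_⟩
  ring

lemma sum {ι : Type*} {A : Finset ι} {f : ι → ℕ → ℝ → ℝ} (h : ∀ i ∈ A, ExpBounded D (f i)) :
    ExpBounded D (fun n t => ∑ i ∈ A, f i n t) := by
  classical
  induction A using Finset.induction_on with
  | empty => simpa using const (D := D) 0
  | insert i A hi ih =>
    simp only [Finset.sum_insert hi]
    exact (h i (by simp)).add (ih fun j hj => h j (by simp [hj]))

lemma log (ha : ExpBounded D a) (ha' : ExpBounded D (fun n t => (a n t)⁻¹))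
    (hpos : ∀ n, ∀ t ∈ D, 0 < a n t) : ExpBounded D (fun n t => Real.log (a n t)) := by
  refine (ha.add ha').of_abs_le fun n t ht => ?_
  have h := hpos n t ht
  have h' : 0 < (a n t)⁻¹ := by positivity
  rw [abs_of_pos (add_pos h h'), abs_le]
  have h1 := Real.log_le_sub_one_of_pos h
  have h2 := Real.one_sub_inv_le_log_of_pos h
  constructor <;> linarith

lemma summable (ha : ExpBounded D a) {t : ℝ} (ht : t ∈ D) :
    Summable fun n : ℕ => t ^ n / (n.factorial : ℝ) * a n t := by
  obtain ⟨C, K, hC, hK, ha⟩ := ha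
  refine Summable.of_norm_bounded ((Real.summable_pow_div_factorial (|t| * K)).mul_left C)
    fun n => ?_
  rw [Real.norm_eq_abs, abs_mul, abs_div, abs_pow, Nat.abs_cast, mul_pow]
  calc |t| ^ n / (n.factorial : ℝ) * |a n t| ≤ |t| ^ n / (n.factorial : ℝ) * (C * K ^ n) := by
        gcongr; exact ha n t ht
    _ = _ := by ring

lemma hasDerivAt_tsum {R : ℝ} {a' : ℕ → ℝ → ℝ} (ha : ExpBounded (Set.Ioo (-R) R) a)
    (ha' : ExpBounded (Set.Ioo (-R) R) a')
    (hd : ∀ n, ∀ t ∈ Set.Ioo (-R) R, HasDerivAt (a n) (a' n t) t)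
    {t : ℝ} (ht : t ∈ Set.Ioo (-R) R) :
    HasDerivAt (fun t => ∑' n : ℕ, t ^ n / (n.factorial : ℝ) * a n t)
      (∑' n : ℕ, t ^ n / (n.factorial : ℝ) * (a (n + 1) t + a' n t)) t := by
  have hR : 0 < R := by linarith [ht.1, ht.2]
  have hsum := ha.summable ht
  have hshift := ha.shift.summable ht
  have hsum' := ha'.summable ht
  obtain ⟨C, K, hC, hK, ha⟩ := ha
  obtain ⟨C', K', hC', hK', ha'⟩ := ha'
  have hfac : ∀ n : ℕ, ((n + 1 : ℕ) : ℝ) / ((n + 1).factorial : ℝ) = 1 / (n.factorial : ℝ) := by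
    intro n
    rw [Nat.factorial_succ]
    push_cast
    field_simp
  have key := hasDerivAt_tsum_of_isPreconnected (𝕜 := ℝ) (F := ℝ) (t := Set.Ioo (-R) R)
    (g := fun (n : ℕ) t => t ^ n / (n.factorial : ℝ) * a n t)
    (g' := fun (n : ℕ) t => (n * t ^ (n - 1)) / (n.factorial : ℝ) * a n t
      + t ^ n / (n.factorial : ℝ) * a' n t)
    (u := fun n : ℕ => (n * R ^ (n - 1)) / (n.factorial : ℝ) * (C * K ^ n)
      + R ^ n / (n.factorial : ℝ) * (C' * K' ^ n)) (y₀ := t) (y := t)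
    ?_ isOpen_Ioo isPreconnected_Ioo ?_ ?_ ht hsum ht
  · refine key.congr_deriv ?_
    have h1 : Summable fun n : ℕ => (n * t ^ (n - 1)) / (n.factorial : ℝ) * a n t := by
      rw [← summable_nat_add_iff 1]
      refine hshift.congr fun n => ?_
      rw [mul_div_right_comm, hfac, Nat.add_sub_cancel]
      ring
    rw [h1.tsum_add hsum', h1.tsum_eq_zero_add]
    simp only [mul_add]
    rw [hshift.tsum_add hsum']
    simp only [CharP.cast_eq_zero, zero_mul, zero_div, zero_add]
    congr 1
    refine tsum_congr fun n => ?_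
    rw [mul_div_right_comm, hfac, Nat.add_sub_cancel]
    ring
  · refine Summable.add ?_ ?_
    · rw [← summable_nat_add_iff 1]
      refine ((Real.summable_pow_div_factorial (R * K)).mul_left (C * K)).congr fun n => ?_
      rw [mul_div_right_comm, hfac, Nat.add_sub_cancel]
      ring
    · refine ((Real.summable_pow_div_factorial (R * K')).mul_left C').congr fun n => ?_
      ring
  · intro n y hy
    exact ((hasDerivAt_pow n y).div_const _).mul (hd n y hy)
  · intro n y hy
    have hy' : |y| ≤ R := abs_le.2 ⟨hy.1.le, hy.2.le⟩
    rw [Real.norm_eq_abs]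
    refine (abs_add_le _ _).trans (add_le_add ?_ ?_)
    · rw [abs_mul, abs_div, abs_mul, abs_pow, Nat.abs_cast, Nat.abs_cast]
      gcongr
      exact ha n y hy
    · rw [abs_mul, abs_div, abs_pow, Nat.abs_cast]
      gcongr
      exact ha' n y hy

end ExpBounded

lemma mem_Ioo_abs_add_one (t : ℝ) : t ∈ Set.Ioo (-(|t| + 1)) (|t| + 1) :=
  ⟨by linarith [neg_abs_le t], by linarith [le_abs_self t]⟩

section PoissonMixture

variable {ι : Type*} {A : Finset ι} {w s : ι → ℝ}

/-- The `n`-th exponentially tilted moment `∑ i, w i * exp (-t * s i) * s i ^ n` of a finitely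
supported law. -/
def tiltedMoment (A : Finset ι) (w s : ι → ℝ) (n : ℕ) (t : ℝ) : ℝ :=
  ∑ i ∈ A, w i * Real.exp (-(t * s i)) * s i ^ n

lemma expBounded_exp_mul_pow (c r R : ℝ) :
    ExpBounded (Set.Ioo (-R) R) (fun n t => c * Real.exp (-(t * r)) * r ^ n) := by
  refine (ExpBounded.of_const_pow (c * Real.exp (R * |r|)) r).of_abs_le fun n t ht => ?_
  rw [abs_mul, abs_mul, abs_mul, abs_mul, Real.abs_exp, Real.abs_exp]
  gcongr
  calc -(t * r) ≤ |t * r| := neg_le_abs _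
    _ = |t| * |r| := abs_mul _ _
    _ ≤ R * |r| := by gcongr; exact abs_le.2 ⟨ht.1.le, ht.2.le⟩

lemma expBounded_tiltedMoment (R : ℝ) : ExpBounded (Set.Ioo (-R) R) (tiltedMoment A w s) :=
  ExpBounded.sum fun i _ => expBounded_exp_mul_pow (w i) (s i) R

lemma hasDerivAt_tiltedMoment (n : ℕ) (t : ℝ) :
    HasDerivAt (tiltedMoment A w s n) (-tiltedMoment A w s (n + 1) t) t := by
  have h : ∀ i ∈ A, HasDerivAt (fun t => w i * Real.exp (-(t * s i)) * s i ^ n)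
      (-(w i * Real.exp (-(t * s i)) * s i ^ (n + 1))) t := by
    intro i _
    refine (((((hasDerivAt_id t).mul_const (s i)).neg.exp).const_mul (w i)).mul_const
      (s i ^ n)).congr_deriv ?_
    simp
    ring
  refine (HasDerivAt.fun_sum h).congr_deriv ?_
  simp [tiltedMoment]

variable (hw : ∀ i ∈ A, 0 ≤ w i) (hs : ∀ i ∈ A, 0 ≤ s i)
  {j : ι} (hj : j ∈ A) (hwj : 0 < w j) (hsj : 0 < s j)

include hw hs hj in
lemma le_tiltedMoment (n : ℕ) (t : ℝ) :
    w j * Real.exp (-(t * s j)) * s j ^ n ≤ tiltedMoment A w s n t := by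
  refine Finset.single_le_sum (f := fun i => w i * Real.exp (-(t * s i)) * s i ^ n) ?_ hj
  intro i hi
  have := hw i hi
  have := hs i hi
  positivity

include hw hs hj hwj hsj in
lemma tiltedMoment_pos (n : ℕ) (t : ℝ) : 0 < tiltedMoment A w s n t :=
  lt_of_lt_of_le (by positivity) (le_tiltedMoment hw hs hj n t)

include hw hs hj hwj hsj in
lemma expBounded_inv_tiltedMoment (R : ℝ) :
    ExpBounded (Set.Ioo (-R) R) (fun n t => (tiltedMoment A w s n t)⁻¹) := by
  refine (ExpBounded.of_const_pow ((w j * Real.exp (-(R * s j)))⁻¹) (s j)⁻¹).of_abs_le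
    fun n t ht => ?_
  have h := tiltedMoment_pos hw hs hj hwj hsj n t
  rw [abs_of_pos (inv_pos.2 h), abs_of_pos (by positivity), inv_pow, ← mul_inv]
  refine inv_anti₀ (by positivity) (le_trans ?_ (le_tiltedMoment hw hs hj n t))
  gcongr
  exact ht.2.le

include hw hs hj hwj hsj in
lemma expBounded_log_tiltedMoment (R : ℝ) :
    ExpBounded (Set.Ioo (-R) R) (fun n t => Real.log (tiltedMoment A w s n t)) :=
  (expBounded_tiltedMoment R).log (expBounded_inv_tiltedMoment hw hs hj hwj hsj R)
    fun n t _ => tiltedMoment_pos hw hs hj hwj hsj n t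

lemma sub_le_mul_log_div {x y : ℝ} (hx : 0 < x) (hy : 0 < y) :
    x - y ≤ x * (Real.log x - Real.log y) := by
  have h := Real.one_sub_inv_le_log_of_pos (div_pos hx hy)
  rw [Real.log_div hx.ne' hy.ne', inv_div] at h
  have := mul_le_mul_of_nonneg_left h hx.le
  have e : x * (1 - y / x) = x - y := by field_simp
  linarith

include hw hs hj hwj hsj in
/-- The series `∑ tⁿ / n! * mₙ(t) log mₙ(t)` built from the tilted moments `mₙ` is convex. -/
lemma convexOn_tsum_tiltedMoment_mul_log :
    ConvexOn ℝ (Set.Ici (0 : ℝ)) (fun t => ∑' n : ℕ, t ^ n / (n.factorial : ℝ) *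
      (tiltedMoment A w s n t * Real.log (tiltedMoment A w s n t))) := by
  set m := tiltedMoment A w s with hm
  have hpos : ∀ n t, 0 < m n t := tiltedMoment_pos hw hs hj hwj hsj
  have hd : ∀ n t, HasDerivAt (m n) (-m (n + 1) t) t := hasDerivAt_tiltedMoment
  have hlog : ∀ n t, HasDerivAt (fun t => Real.log (m n t)) (-m (n + 1) t / m n t) t :=
    fun n t => (hd n t).log (hpos n t).ne'
  have bm : ∀ R, ExpBounded (Set.Ioo (-R) R) m := expBounded_tiltedMoment
  have bi : ∀ R, ExpBounded (Set.Ioo (-R) R) (fun n t => (m n t)⁻¹) :=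
    expBounded_inv_tiltedMoment hw hs hj hwj hsj
  have bl : ∀ R, ExpBounded (Set.Ioo (-R) R) (fun n t => Real.log (m n t)) :=
    expBounded_log_tiltedMoment hw hs hj hwj hsj
  let b : ℕ → ℝ → ℝ := fun n t => m (n + 1) t * (Real.log (m (n + 1) t) - Real.log (m n t) - 1)
  let b' : ℕ → ℝ → ℝ := fun n t =>
    -m (n + 2) t * (Real.log (m (n + 1) t) - Real.log (m n t) - 1) +
      m (n + 1) t * (-m (n + 2) t * (m (n + 1) t)⁻¹ - -m (n + 1) t * (m n t)⁻¹)
  have bb : ∀ R, ExpBounded (Set.Ioo (-R) R) b := fun R =>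
    (bm R).shift.mul (((bl R).shift.sub (bl R)).sub (.const 1))
  have bb' : ∀ R, ExpBounded (Set.Ioo (-R) R) b' := fun R =>
    ((bm R).shift.shift.neg.mul (((bl R).shift.sub (bl R)).sub (.const 1))).add
      ((bm R).shift.mul (((bm R).shift.shift.neg.mul (bi R).shift).sub
        ((bm R).shift.neg.mul (bi R))))
  have hb : ∀ n t, HasDerivAt (b n) (b' n t) t := by
    intro n t
    exact (hd (n + 1) t).mul (((hlog (n + 1) t).sub (hlog n t)).sub_const 1)
  have d1 : ∀ t, HasDerivAt
      (fun t => ∑' n : ℕ, t ^ n / (n.factorial : ℝ) * (m n t * Real.log (m n t)))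
      (∑' n : ℕ, t ^ n / (n.factorial : ℝ) * b n t) t := by
    intro t
    refine (((bm (|t| + 1)).mul (bl _)).hasDerivAt_tsum
      (a' := fun n t => -m (n + 1) t * Real.log (m n t) + m n t * (-m (n + 1) t * (m n t)⁻¹))
      (((bm _).shift.neg.mul (bl _)).add ((bm _).mul ((bm _).shift.neg.mul (bi _))))
      (fun n t _ => (hd n t).mul (hlog n t)) (mem_Ioo_abs_add_one t)).congr_deriv ?_
    refine tsum_congr fun n => ?_
    have := (hpos n t).ne'
    simp only [b]
    field_simp
    ring
  have d2 : ∀ t, HasDerivAt (fun t => ∑' n : ℕ, t ^ n / (n.factorial : ℝ) * b n t)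
      (∑' n : ℕ, t ^ n / (n.factorial : ℝ) * (b (n + 1) t + b' n t)) t :=
    fun t => (bb (|t| + 1)).hasDerivAt_tsum (bb' _) (fun n t _ => hb n t) (mem_Ioo_abs_add_one t)
  refine convexOn_of_hasDerivWithinAt2_nonneg (convex_Ici 0)
    (fun t _ => (d1 t).continuousAt.continuousWithinAt)
    (fun t _ => (d1 t).hasDerivWithinAt) (fun t _ => (d2 t).hasDerivWithinAt) fun t ht => ?_
  have ht0 : 0 ≤ t := interior_subset ht
  refine tsum_nonneg fun n => mul_nonneg (by positivity) ?_
  have h0 := hpos n t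
  have h1 := hpos (n + 1) t
  have h2 := hpos (n + 2) t
  have key := sub_le_mul_log_div h2 (div_pos (mul_pos h1 h1) h0)
  rw [Real.log_div (by positivity) h0.ne', Real.log_mul h1.ne' h1.ne'] at key
  have e : b (n + 1) t + b' n t =
      m (n + 2) t * (Real.log (m (n + 2) t)
        - (Real.log (m (n + 1) t) + Real.log (m (n + 1) t) - Real.log (m n t)))
      - (m (n + 2) t - m (n + 1) t * m (n + 1) t / m n t) := by
    simp only [b, b']
    field_simp
    ring
  rw [e]
  linarith

lemma hasSum_mul_pow_div_factorial (x : ℝ) :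
    HasSum (fun n : ℕ => n * (x ^ n / (n.factorial : ℝ))) (x * Real.exp x) := by
  have h : HasSum (fun n : ℕ => x ^ n / (n.factorial : ℝ)) (Real.exp x) := by
    rw [Real.exp_eq_exp_ℝ]
    exact NormedSpace.expSeries_div_hasSum_exp x
  rw [← hasSum_nat_add_iff' 1]
  simp only [Finset.range_one, Finset.sum_singleton, Nat.cast_zero, zero_mul, sub_zero]
  refine (h.mul_left x).congr_fun fun n => ?_
  rw [Nat.factorial_succ]
  push_cast
  field_simp
  ring

/-- The entropy-type series of one weighted Poisson law, with the factor `tⁿ / n!` taken out of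
the logarithm. -/
lemma hasSum_negMulLog_weighted_exp_mul_pow (w s t : ℝ) :
    HasSum (fun n : ℕ => t ^ n / (n.factorial : ℝ) *
      Real.negMulLog (w * Real.exp (-(t * s)) * s ^ n))
      (Real.negMulLog w + t * (w * s - w * (s * Real.log s))) := by
  have h : HasSum (fun n : ℕ => (t * s) ^ n / (n.factorial : ℝ)) (Real.exp (t * s)) := by
    rw [Real.exp_eq_exp_ℝ]
    exact NormedSpace.expSeries_div_hasSum_exp _
  have e : Real.exp (-(t * s)) * Real.exp (t * s) = 1 := by
    rw [← Real.exp_add]; simp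
  have key := (h.mul_left (-(w * (Real.log w - t * s) * Real.exp (-(t * s))))).add
    ((hasSum_mul_pow_div_factorial (t * s)).mul_left
      (-(w * Real.log s * Real.exp (-(t * s)))))
  have hv : Real.negMulLog w + t * (w * s - w * (s * Real.log s)) =
      -(w * (Real.log w - t * s) * Real.exp (-(t * s))) * Real.exp (t * s) +
        -(w * Real.log s * Real.exp (-(t * s))) * (t * s * Real.exp (t * s)) := by
    rw [Real.negMulLog]
    linear_combination (w * (Real.log w - t * s) + w * Real.log s * (t * s)) * e
  rw [hv]
  refine key.congr_fun fun n => ?_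
  rcases eq_or_ne w 0 with rfl | hw
  · simp
  have hl : s ^ n * Real.log (w * Real.exp (-(t * s)) * s ^ n) =
      s ^ n * (Real.log w - t * s + n * Real.log s) := by
    rcases eq_or_ne (s ^ n) 0 with h0 | h0
    · simp [h0]
    · rw [Real.log_mul (by positivity) h0, Real.log_mul hw (by positivity), Real.log_exp,
        Real.log_pow]
      ring
  calc t ^ n / (n.factorial : ℝ) * Real.negMulLog (w * Real.exp (-(t * s)) * s ^ n)
      = -(t ^ n / (n.factorial : ℝ) * (w * Real.exp (-(t * s))) *
        (s ^ n * Real.log (w * Real.exp (-(t * s)) * s ^ n))) := by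
        rw [Real.negMulLog]; ring
    _ = _ := by rw [hl, mul_pow]; ring

lemma negMulLog_pow_div_factorial (t : ℝ) (n : ℕ) :
    Real.negMulLog (t ^ n / (n.factorial : ℝ)) =
      t ^ n / (n.factorial : ℝ) * (Real.log n.factorial - n * Real.log t) := by
  have hf : (n.factorial : ℝ) ≠ 0 := by positivity
  rcases eq_or_ne (t ^ n) 0 with h | h
  · simp [h]
  · rw [Real.negMulLog, Real.log_div h hf, Real.log_pow]
    ring

lemma expBounded_log_factorial (D : Set ℝ) :
    ExpBounded D (fun n _ => Real.log n.factorial) := by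
  refine (ExpBounded.natCast.mul ExpBounded.natCast).of_abs_le fun n t _ => ?_
  have h1 : (1 : ℝ) ≤ n.factorial := by exact_mod_cast n.factorial_pos
  rw [abs_of_nonneg (Real.log_nonneg h1), abs_of_nonneg (by positivity)]
  calc Real.log n.factorial ≤ Real.log ((n : ℝ) ^ n) :=
        Real.log_le_log (by positivity) (by exact_mod_cast n.factorial_le_pow)
    _ = n * Real.log n := Real.log_pow _ _
    _ ≤ n * n := by gcongr; exact Real.log_le_self (by positivity)

lemma summable_mul_negMulLog_pow_div_factorial (w s t : ℝ) :
    Summable fun n : ℕ => w * Real.exp (-(t * s)) * s ^ n *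
      Real.negMulLog (t ^ n / (n.factorial : ℝ)) := by
  refine (((expBounded_exp_mul_pow w s (|t| + 1)).mul ((expBounded_log_factorial _).sub
    (ExpBounded.natCast.mul (.const (Real.log t))))).summable
    (mem_Ioo_abs_add_one t)).congr fun n => ?_
  rw [negMulLog_pow_div_factorial]
  ring

lemma summable_negMulLog_weighted_poisson (w s t : ℝ) :
    Summable fun n : ℕ => Real.negMulLog
      (t ^ n / (n.factorial : ℝ) * (w * Real.exp (-(t * s)) * s ^ n)) := by
  simp only [Real.negMulLog_mul (_ / _)]
  exact (summable_mul_negMulLog_pow_div_factorial w s t).add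
    (hasSum_negMulLog_weighted_exp_mul_pow w s t).summable

include hw hs hj hwj hsj in
/-- The mutual information of a finitely supported input and its Poisson output, written as
a linear function of the time minus a convex series. -/
lemma poisson_mutualInfo_series (t : ℝ) :
    ∑ i ∈ A, Real.negMulLog (w i) +
      ∑' n : ℕ, Real.negMulLog
        (∑ i ∈ A, t ^ n / (n.factorial : ℝ) * (w i * Real.exp (-(t * s i)) * s i ^ n)) -
      ∑ i ∈ A, ∑' n : ℕ, Real.negMulLog
        (t ^ n / (n.factorial : ℝ) * (w i * Real.exp (-(t * s i)) * s i ^ n)) =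
    t * ∑ i ∈ A, (w i * (s i * Real.log (s i)) - w i * s i) -
      ∑' n : ℕ, t ^ n / (n.factorial : ℝ) *
        (tiltedMoment A w s n t * Real.log (tiltedMoment A w s n t)) := by
  have hB := fun i => summable_mul_negMulLog_pow_div_factorial (w i) (s i) t
  have hC := fun i => hasSum_negMulLog_weighted_exp_mul_pow (w i) (s i) t
  have hF := ((expBounded_tiltedMoment (A := A) (w := w) (s := s) (|t| + 1)).mul
    (expBounded_log_tiltedMoment hw hs hj hwj hsj (|t| + 1))).summable (mem_Ioo_abs_add_one t)
  have h1 : ∑' n : ℕ, Real.negMulLog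
      (∑ i ∈ A, t ^ n / (n.factorial : ℝ) * (w i * Real.exp (-(t * s i)) * s i ^ n)) =
      ∑ i ∈ A, ∑' n : ℕ, w i * Real.exp (-(t * s i)) * s i ^ n *
        Real.negMulLog (t ^ n / (n.factorial : ℝ)) -
      ∑' n : ℕ, t ^ n / (n.factorial : ℝ) *
        (tiltedMoment A w s n t * Real.log (tiltedMoment A w s n t)) := by
    rw [← Summable.tsum_finsetSum fun i _ => hB i,
      ← (summable_sum fun i _ => hB i).tsum_sub hF]
    refine tsum_congr fun n => ?_
    rw [← Finset.mul_sum, Real.negMulLog_mul, ← Finset.sum_mul]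
    simp only [tiltedMoment, Real.negMulLog]
    ring
  have h2 : ∀ i, ∑' n : ℕ, Real.negMulLog
      (t ^ n / (n.factorial : ℝ) * (w i * Real.exp (-(t * s i)) * s i ^ n)) =
      ∑' n : ℕ, w i * Real.exp (-(t * s i)) * s i ^ n *
        Real.negMulLog (t ^ n / (n.factorial : ℝ)) +
      (Real.negMulLog (w i) - t * (w i * (s i * Real.log (s i)) - w i * s i)) := by
    intro i
    simp only [Real.negMulLog_mul (_ / _)]
    rw [(hB i).tsum_add (hC i).summable, (hC i).tsum_eq]
    ring
  rw [h1]
  simp only [h2, Finset.sum_add_distrib, Finset.sum_sub_distrib, ← Finset.mul_sum]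
  ring

end PoissonMixture

section FiniteSupport

variable {S U : Type*} [MeasurableSpace S] [MeasurableSpace U]

lemma measureEntropy_eq_tsum (μ : Measure S) [IsProbabilityMeasure μ] :
    measureEntropy μ = ∑' x, Real.negMulLog (μ.real {x}) := by
  simp [measureEntropy, measureReal_def]

variable [MeasurableSingletonClass S]

lemma aemeasurable_restrict_finset (f : S → U) (μ : Measure S) (A : Finset S) :
    AEMeasurable f (μ.restrict A) := by
  have hA : (A : Set S) = ⋃ a : A, {(a : S)} := by ext; simp
  rw [hA, aemeasurable_iUnion_iff]
  intro a
  rw [Measure.restrict_singleton]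
  exact aemeasurable_dirac.smul_measure _

variable {ν : Measure S} {A : Finset S} {κ : S → Measure U}

lemma bind_map_mk_apply (hA : ν (A : Set S)ᶜ = 0) {B : Set (S × U)} (hB : MeasurableSet B) :
    (ν.bind fun x => (κ x).map fun y => (x, y)) B =
      ∑ x ∈ A, ν {x} * κ x (Prod.mk x ⁻¹' B) := by
  have hr : ν.restrict (A : Set S) = ν :=
    Measure.restrict_eq_self_of_ae_mem (mem_ae_iff.2 hA)
  rw [← hr, Measure.bind_apply hB (aemeasurable_restrict_finset _ _ _), lintegral_finset, hr]
  refine Finset.sum_congr rfl fun x _ => ?_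
  rw [Measure.map_apply measurable_prodMk_left hB, mul_comm]

variable [IsProbabilityMeasure ν] [∀ x, IsProbabilityMeasure (κ x)]

lemma isProbabilityMeasure_bind_map_mk (hA : ν (A : Set S)ᶜ = 0) :
    IsProbabilityMeasure (ν.bind fun x => (κ x).map fun y => (x, y)) := by
  constructor
  rw [bind_map_mk_apply hA .univ]
  simp only [Set.preimage_univ, measure_univ, mul_one, sum_measure_singleton]
  exact (prob_compl_eq_zero_iff A.measurableSet).1 hA

variable [MeasurableSingletonClass U]

/-- The mutual information of a channel `κ` with finitely supported input law `ν`. -/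
lemma measureMutualInfo_bind_map_mk (hA : ν (A : Set S)ᶜ = 0)
    (hsum : ∀ x ∈ A, Summable fun y => Real.negMulLog (ν.real {x} * (κ x).real {y})) :
    measureMutualInfo (ν.bind fun x => (κ x).map fun y => (x, y)) =
      ∑ x ∈ A, Real.negMulLog (ν.real {x}) +
        ∑' y, Real.negMulLog (∑ x ∈ A, ν.real {x} * (κ x).real {y}) -
        ∑ x ∈ A, ∑' y, Real.negMulLog (ν.real {x} * (κ x).real {y}) := by
  classical
  set μ := ν.bind fun x => (κ x).map fun y => (x, y) with hμ
  have : IsProbabilityMeasure μ := isProbabilityMeasure_bind_map_mk hA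
  have : IsProbabilityMeasure (μ.map Prod.fst) :=
    Measure.isProbabilityMeasure_map measurable_fst.aemeasurable
  have : IsProbabilityMeasure (μ.map Prod.snd) :=
    Measure.isProbabilityMeasure_map measurable_snd.aemeasurable
  have hν : ∀ x ∉ A, ν {x} = 0 := fun x hx =>
    measure_mono_null (by simpa using hx) hA
  have hreal : ∀ B, MeasurableSet B →
      μ.real B = ∑ x ∈ A, ν.real {x} * (κ x).real (Prod.mk x ⁻¹' B) := by
    intro B hB
    rw [measureReal_def, hμ, bind_map_mk_apply hA hB, ENNReal.toReal_sum fun x _ => by finiteness]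
    simp [measureReal_def]
  have hfst : ∀ x, (μ.map Prod.fst).real {x} = ν.real {x} := by
    intro x
    rw [map_measureReal_apply measurable_fst (measurableSet_singleton x),
      hreal _ (measurable_fst (measurableSet_singleton x))]
    by_cases hx : x ∈ A
    · rw [Finset.sum_eq_single_of_mem x hx]
      · rw [show Prod.mk x ⁻¹' (Prod.fst ⁻¹' {x}) = (Set.univ : Set U) by ext; simp]
        simp
      · intro z _ hz
        rw [show Prod.mk z ⁻¹' (Prod.fst ⁻¹' {x}) = (∅ : Set U) by ext; simp [hz]]
        simp
    · rw [Finset.sum_eq_zero, measureReal_def, hν x hx]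
      · simp
      · intro z hz
        have hz : z ≠ x := fun h => hx (h ▸ hz)
        rw [show Prod.mk z ⁻¹' (Prod.fst ⁻¹' {x}) = (∅ : Set U) by ext; simp [hz]]
        simp
  have hsnd : ∀ y, (μ.map Prod.snd).real {y} = ∑ x ∈ A, ν.real {x} * (κ x).real {y} := by
    intro y
    rw [map_measureReal_apply measurable_snd (measurableSet_singleton y),
      hreal _ (measurable_snd (measurableSet_singleton y))]
    rfl
  have hmk : ∀ (x : S) (y : U) (z : S), z ≠ x → Prod.mk z ⁻¹' {(x, y)} = (∅ : Set U) := by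
    intro x y z hz
    ext
    simp [hz]
  have hin : ∀ x ∈ A, ∀ y, μ.real {(x, y)} = ν.real {x} * (κ x).real {y} := by
    intro x hx y
    rw [hreal _ (measurableSet_singleton _), Finset.sum_eq_single_of_mem x hx]
    · congr 2
      ext
      simp
    · intro z _ hz
      simp [hmk x y z hz]
  have hout : ∀ x ∉ A, ∀ y, μ.real {(x, y)} = 0 := by
    intro x hx y
    rw [hreal _ (measurableSet_singleton _)]
    refine Finset.sum_eq_zero fun z hz => ?_
    simp [hmk x y z fun h => hx (h ▸ hz)]
  have hjoint : HasSum (fun z : S × U => Real.negMulLog (μ.real {z}))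
      (∑ x ∈ A, ∑' y, Real.negMulLog (ν.real {x} * (κ x).real {y})) := by
    have h : ∀ x ∈ A, HasSum
        (fun z : S × U => if z.1 = x then Real.negMulLog (μ.real {z}) else 0)
        (∑' y, Real.negMulLog (ν.real {x} * (κ x).real {y})) := by
      intro x hx
      refine (Function.Injective.hasSum_iff (Prod.mk_right_injective x) ?_).1 ?_
      · rintro ⟨a, b⟩ hab
        have : a ≠ x := fun h => hab ⟨b, by rw [h]⟩
        simp [this]
      · simpa [Function.comp_def, hin x hx] using (hsum x hx).hasSum
    refine (hasSum_sum h).congr_fun fun z => ?_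
    obtain ⟨x, y⟩ := z
    by_cases hx : x ∈ A
    · simp [hx]
    · simp [hout x hx y]
  rw [measureMutualInfo, measureEntropy_eq_tsum, measureEntropy_eq_tsum, measureEntropy_eq_tsum μ,
    hjoint.tsum_eq]
  simp only [hfst, hsnd]
  rw [tsum_eq_sum fun x hx => by rw [measureReal_def, hν x hx]; simp]

end FiniteSupport

instance (r : ℝ) : IsProbabilityMeasure (poissonMeasure r) :=
  PMF.toMeasure.isProbabilityMeasure _

lemma poissonMeasure_real_singleton_mul {t s : ℝ} (ht : 0 ≤ t) (hs : 0 ≤ s) (n : ℕ) :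
    (poissonMeasure (t * s)).real {n} =
      t ^ n / (n.factorial : ℝ) * (Real.exp (-(t * s)) * s ^ n) := by
  rw [measureReal_def, _root_.poissonMeasure,
    PMF.toMeasure_apply_singleton _ _ (measurableSet_singleton n)]
  change (ENNReal.ofReal (Real.exp (-((t * s).toNNReal : ℝ)) * ((t * s).toNNReal : ℝ) ^ n /
    (n.factorial : ℝ))).toReal = _
  rw [ENNReal.toReal_ofReal (by positivity), Real.coe_toNNReal _ (mul_nonneg ht hs), mul_pow]
  ring

section InputLaw

variable {p lam0 lam1 : ℝ}

lemma isProbabilityMeasure_inputLaw (hp0 : 0 ≤ p) (hp1 : p ≤ 1) :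
    IsProbabilityMeasure (inputLaw p lam0 lam1) := by
  constructor
  simp only [inputLaw, Measure.add_apply, Measure.smul_apply, measure_univ, smul_eq_mul, mul_one]
  rw [← ENNReal.ofReal_add hp0 (by linarith)]
  simp

lemma isProbabilityMeasure_XLaw (hp0 : 0 ≤ p) (hp1 : p ≤ 1) :
    IsProbabilityMeasure (XLaw p lam0 lam1) := by
  have := isProbabilityMeasure_inputLaw (lam0 := lam0) (lam1 := lam1) hp0 hp1
  unfold XLaw
  infer_instance

/-- The finite set of input vectors charged by `XLaw`. -/
def inputSupport (lam0 lam1 : ℝ) : Finset (Fin 4 → ℝ) :=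
  Fintype.piFinset fun _ => {lam0, lam1}

lemma XLaw_compl_inputSupport (hp0 : 0 ≤ p) (hp1 : p ≤ 1) :
    XLaw p lam0 lam1 (inputSupport lam0 lam1 : Set (Fin 4 → ℝ))ᶜ = 0 := by
  have := isProbabilityMeasure_inputLaw (lam0 := lam0) (lam1 := lam1) hp0 hp1
  have := isProbabilityMeasure_XLaw (lam0 := lam0) (lam1 := lam1) hp0 hp1
  rw [prob_compl_eq_zero_iff (Finset.measurableSet _), inputSupport, Fintype.coe_piFinset, XLaw,
    Measure.pi_pi]
  refine Finset.prod_eq_one fun i _ => ?_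
  rw [← prob_compl_eq_zero_iff (Finset.measurableSet _)]
  simp [inputLaw]

lemma XLaw_singleton_const_pos (hp0 : 0 < p) (hp1 : p ≤ 1) :
    0 < (XLaw p lam0 lam1).real {fun _ => lam1} := by
  have := isProbabilityMeasure_inputLaw (lam0 := lam0) (lam1 := lam1) hp0.le hp1
  have := isProbabilityMeasure_XLaw (lam0 := lam0) (lam1 := lam1) hp0.le hp1
  rw [measureReal_def, ENNReal.toReal_pos_iff]
  refine ⟨?_, measure_lt_top _ _⟩
  rw [XLaw, Measure.pi_singleton, CanonicallyOrderedAdd.prod_pos]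
  intro i _
  simp [inputLaw, hp0]

end InputLaw

/-- `T ↦ I(X₁,…,X₄; Y₁₅)` with `T₁₅ = T` and all other times `0`
(so `Y₁₅ ~ Poisson(T·(X₁+X₂+X₃+X₄))` given `X`) is concave on `[0,∞)`. -/
theorem poisson_mutualInfo_joint_concave
    (p lam0 lam1 : ℝ) (hlam0 : 0 ≤ lam0) (hlam : lam0 < lam1) (hp0 : 0 < p) (hp1 : p < 1) :
    ConcaveOn ℝ (Set.Ici (0 : ℝ)) (fun T : ℝ =>
      measureMutualInfo (poissonJointLaw p lam0 lam1
        (fun i => if i.val = 14 then T else 0)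
        (fun _ : Fin 1 => (14 : Fin 15)))) := by
  have := isProbabilityMeasure_XLaw (lam0 := lam0) (lam1 := lam1) hp0.le hp1.le
  set A := inputSupport lam0 lam1 with hAdef
  have hA : XLaw p lam0 lam1 (A : Set (Fin 4 → ℝ))ᶜ = 0 := XLaw_compl_inputSupport hp0.le hp1.le
  let w : (Fin 4 → ℝ) → ℝ := fun x => (XLaw p lam0 lam1).real {x}
  let s : (Fin 4 → ℝ) → ℝ := fun x => ∑ j ∈ sens 14, x j
  have hw : ∀ x ∈ A, 0 ≤ w x := fun x _ => measureReal_nonneg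
  have hs : ∀ x ∈ A, 0 ≤ s x := by
    intro x hx
    refine Finset.sum_nonneg fun j _ => ?_
    have := Fintype.mem_piFinset.1 hx j
    rcases Finset.mem_insert.1 this with h | h
    · rw [h]; exact hlam0
    · rw [Finset.mem_singleton.1 h]; linarith
  have hj : (fun _ => lam1 : Fin 4 → ℝ) ∈ A := by simp [hAdef, inputSupport]
  have hwj : 0 < w fun _ => lam1 := XLaw_singleton_const_pos hp0 hp1.le
  have hsj : 0 < s fun _ => lam1 :=
    Finset.sum_pos (fun _ _ => hlam0.trans_lt hlam) ⟨0, by simp [sens]⟩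
  have hκ : ∀ T ∈ Set.Ici (0 : ℝ), ∀ x ∈ A, ∀ y : Fin 1 → ℕ,
      w x * (Measure.pi fun _ : Fin 1 => poissonMeasure (T * s x)).real {y} =
        T ^ y 0 / ((y 0).factorial : ℝ) * (w x * Real.exp (-(T * s x)) * s x ^ y 0) := by
    intro T hT x hx y
    rw [measureReal_def, Measure.pi_singleton, Fin.prod_univ_one, ← measureReal_def,
      poissonMeasure_real_singleton_mul hT (hs x hx)]
    ring
  have heq : ∀ T ∈ Set.Ici (0 : ℝ), measureMutualInfo (poissonJointLaw p lam0 lam1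
        (fun i => if i.val = 14 then T else 0) (fun _ : Fin 1 => (14 : Fin 15))) =
      T * ∑ x ∈ A, (w x * (s x * Real.log (s x)) - w x * s x) -
        ∑' n : ℕ, T ^ n / (n.factorial : ℝ) *
          (tiltedMoment A w s n T * Real.log (tiltedMoment A w s n T)) := by
    intro T hT
    have hmi := measureMutualInfo_bind_map_mk (ν := XLaw p lam0 lam1)
      (κ := fun x => Measure.pi fun _ : Fin 1 => poissonMeasure (T * s x)) hA ?_
    · refine Eq.trans hmi ?_
      rw [← poisson_mutualInfo_series hw hs hj hwj hsj T]
      refine congrArg₂ (· - ·) (congrArg (_ + ·) ?_) ?_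
      · rw [← (Equiv.funUnique (Fin 1) ℕ).tsum_eq]
        refine tsum_congr fun y => congrArg Real.negMulLog ?_
        exact Finset.sum_congr rfl fun x hx => hκ T hT x hx y
      · refine Finset.sum_congr rfl fun x hx => ?_
        rw [← (Equiv.funUnique (Fin 1) ℕ).tsum_eq]
        exact tsum_congr fun y => congrArg Real.negMulLog (hκ T hT x hx y)
    · intro x hx
      refine ((Equiv.funUnique (Fin 1) ℕ).summable_iff.2
        (summable_negMulLog_weighted_poisson (w x) (s x) T)).congr fun y => ?_
      exact congrArg Real.negMulLog (hκ T hT x hx y).symm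
  have hconv := convexOn_tsum_tiltedMoment_mul_log hw hs hj hwj hsj
  have hlin : ConcaveOn ℝ (Set.Ici (0 : ℝ))
      (fun T : ℝ => T * ∑ x ∈ A, (w x * (s x * Real.log (s x)) - w x * s x)) :=
    (LinearMap.mulRight ℝ _ : ℝ →ₗ[ℝ] ℝ).concaveOn (convex_Ici 0)
  exact (hlin.sub hconv).congr fun T hT => (heq T hT).symm
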